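/- arXiv:2411.13966 — 6 statements merged into one kernel-verified Lean document; each statement's English description precedes it below -/
import Mathlib

section
/- For all integers n and p with 1 < p < n-1, the norm-comparison constants satisfy C_{n,p}² ≤ C_{n-1,p-1}² + C_{n-1,p}², where ℝ^{n-1} is identified with the span of the first n-1 standard basis vectors of ℝⁿ. -/
open scoped Classical

/-- A `p`-covector on `ℝⁿ`: a continuous alternating `p`-linear form on
`EuclideanSpace ℝ (Fin n)`. -/
abbrev Covector (n p : ℕ) := EuclideanSpace ℝ (Fin n) [⋀^Fin p]→L[ℝ] ℝ

/-- The comass of a real-valued function of `p` vectors in `ℝⁿ`: the supremum of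
its absolute values on orthonormal families. -/
noncomputable def comassFun {n p : ℕ}
    (F : (Fin p → EuclideanSpace ℝ (Fin n)) → ℝ) : ℝ :=
  sSup {r : ℝ | ∃ v : Fin p → EuclideanSpace ℝ (Fin n), Orthonormal ℝ v ∧ r = |F v|}

/-- The comass norm `‖φ‖*` of a `p`-covector. -/
noncomputable def comass {n p : ℕ} (φ : Covector n p) : ℝ :=
  comassFun (fun v => φ v)

/-- The Euclidean norm `|φ|*` of a `p`-covector, computed from its coefficients
on the standard orthonormal basis, indexed by strictly increasing multi-indices. -/
noncomputable def euclNorm {n p : ℕ} (φ : Covector n p) : ℝ :=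
  Real.sqrt (∑ f : {f : Fin p → Fin n // StrictMono f},
    (φ (fun i => EuclideanSpace.single (f.1 i) 1)) ^ 2)

/-- The norm-comparison constant `C_{n,p}`: the supremum of `|φ|*/‖φ‖*` over all
nonzero `p`-covectors on `ℝⁿ`. -/
noncomputable def normComparisonConst (n p : ℕ) : ℝ :=
  sSup {r : ℝ | ∃ φ : Covector n p, φ ≠ 0 ∧ r = euclNorm φ / comass φ}

lemma comassSet_bdd {n p : ℕ} (φ : Covector n p) :
    BddAbove {r : ℝ | ∃ v : Fin p → EuclideanSpace ℝ (Fin n), Orthonormal ℝ v ∧ r = |φ v|} := by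
  refine ⟨‖φ‖, ?_⟩
  rintro r ⟨v, hv, rfl⟩
  have := φ.le_opNorm v
  simpa [hv.1, Real.norm_eq_abs] using this

lemma le_comass {n p : ℕ} (φ : Covector n p) {v : Fin p → EuclideanSpace ℝ (Fin n)}
    (hv : Orthonormal ℝ v) : |φ v| ≤ comass φ :=
  le_csSup (comassSet_bdd φ) ⟨v, hv, rfl⟩

lemma comass_nonneg' {n p : ℕ} (φ : Covector n p) : 0 ≤ comass φ := by
  apply Real.sSup_nonneg
  rintro r ⟨v, hv, rfl⟩
  exact abs_nonneg _

lemma comass_le {n p : ℕ} (φ : Covector n p) {c : ℝ} (hc : 0 ≤ c)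
    (h : ∀ v : Fin p → EuclideanSpace ℝ (Fin n), Orthonormal ℝ v → |φ v| ≤ c) :
    comass φ ≤ c := by
  apply Real.sSup_le _ hc
  rintro r ⟨v, hv, rfl⟩
  exact h v hv

lemma orthonormal_single {n p : ℕ} {f : Fin p → Fin n} (hf : Function.Injective f) :
    Orthonormal ℝ (fun i => (EuclideanSpace.single (f i) 1 : EuclideanSpace ℝ (Fin n))) := by
  have := (EuclideanSpace.basisFun (Fin n) ℝ).orthonormal.comp f hf
  simpa [Function.comp_def] using this

lemma comass_pos {n p : ℕ} (φ : Covector n p) (h : φ ≠ 0) : 0 < comass φ := by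
  rcases (comass_nonneg' φ).lt_or_eq with h0 | h0
  · exact h0
  · exfalso
    apply h
    apply ContinuousAlternatingMap.toAlternatingMap_injective
    apply Module.Basis.ext_alternating (EuclideanSpace.basisFun (Fin n) ℝ).toBasis
    intro v hv
    have := le_comass φ (orthonormal_single hv)
    rw [← h0] at this
    simpa using this

lemma euclNorm_sq {n p : ℕ} (φ : Covector n p) :
    euclNorm φ ^ 2 = ∑ f : {f : Fin p → Fin n // StrictMono f},
      (φ (fun i => EuclideanSpace.single (f.1 i) 1)) ^ 2 :=
  Real.sq_sqrt (Finset.sum_nonneg fun _ _ => sq_nonneg _)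

lemma const_bdd (n p : ℕ) :
    BddAbove {r : ℝ | ∃ φ : Covector n p, φ ≠ 0 ∧ r = euclNorm φ / comass φ} := by
  refine ⟨Real.sqrt (Fintype.card {f : Fin p → Fin n // StrictMono f}), ?_⟩
  rintro r ⟨φ, h, rfl⟩
  have hp := comass_pos φ h
  rw [div_le_iff₀ hp]
  apply le_of_sq_le_sq _ (by positivity)
  rw [euclNorm_sq, mul_pow, Real.sq_sqrt (by positivity), ← nsmul_eq_mul]
  apply Finset.sum_le_card_nsmul
  intro f _
  rw [← sq_abs]
  exact pow_le_pow_left₀ (abs_nonneg _) (le_comass φ (orthonormal_single f.2.injective)) 2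

lemma const_nonneg (n p : ℕ) : 0 ≤ normComparisonConst n p := by
  apply Real.sSup_nonneg
  rintro r ⟨φ, h, rfl⟩
  exact div_nonneg (Real.sqrt_nonneg _) (comass_nonneg' φ)

lemma euclNorm_le {n p : ℕ} (φ : Covector n p) :
    euclNorm φ ≤ normComparisonConst n p * comass φ := by
  by_cases h : φ = 0
  · subst h
    have : euclNorm (0 : Covector n p) = 0 := by simp [euclNorm]
    rw [this]
    exact mul_nonneg (const_nonneg _ _) (comass_nonneg' _)
  · rw [← div_le_iff₀ (comass_pos φ h)]
    exact le_csSup (const_bdd n p) ⟨φ, h, rfl⟩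

/-- The isometric inclusion of `ℝᵐ` in `ℝᵐ⁺¹` missing the first coordinate. -/
noncomputable def incl (m : ℕ) : EuclideanSpace ℝ (Fin m) →L[ℝ] EuclideanSpace ℝ (Fin (m + 1)) :=
  LinearMap.toContinuousLinearMap
    { toFun := fun x => WithLp.toLp 2 (Fin.cons 0 (fun i => x i))
      map_add' := by
        intro x y
        ext i
        refine Fin.cases ?_ (fun j => ?_) i <;> simp
      map_smul' := by
        intro c x
        ext i
        refine Fin.cases ?_ (fun j => ?_) i <;> simp }

@[simp] lemma incl_zero {m : ℕ} (x : EuclideanSpace ℝ (Fin m)) : incl m x 0 = 0 := rfl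
@[simp] lemma incl_succ {m : ℕ} (x : EuclideanSpace ℝ (Fin m)) (i : Fin m) :
    incl m x i.succ = x i := rfl

lemma incl_single {m : ℕ} (i : Fin m) :
    incl m (EuclideanSpace.single i 1) = EuclideanSpace.single i.succ 1 := by
  ext j
  refine Fin.cases ?_ (fun k => ?_) j
  · simp [(Fin.succ_ne_zero i).symm]
  · simp [Pi.single_apply]

lemma incl_inner {m : ℕ} (x y : EuclideanSpace ℝ (Fin m)) :
    inner ℝ (incl m x) (incl m y) = inner ℝ x y := by
  simp [PiLp.inner_apply, Fin.sum_univ_succ]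

lemma incl_orthonormal {m q : ℕ} {v : Fin q → EuclideanSpace ℝ (Fin m)} (hv : Orthonormal ℝ v) :
    Orthonormal ℝ (fun i => incl m (v i)) := by
  rw [orthonormal_iff_ite] at hv ⊢
  intro i j
  rw [incl_inner, hv]

lemma cons_orthonormal {m q : ℕ} {v : Fin q → EuclideanSpace ℝ (Fin m)} (hv : Orthonormal ℝ v) :
    Orthonormal ℝ (Fin.cons (EuclideanSpace.single 0 1) (fun i => incl m (v i)) :
      Fin (q + 1) → EuclideanSpace ℝ (Fin (m + 1))) := by
  rw [orthonormal_iff_ite] at hv ⊢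
  intro i j
  refine Fin.cases ?_ (fun k => ?_) i <;> refine Fin.cases ?_ (fun l => ?_) j
  · simp
  · simp [EuclideanSpace.inner_single_left, (Fin.succ_ne_zero l).symm]
  · simp [EuclideanSpace.inner_single_right]
  · simp [incl_inner, hv]

noncomputable def betaPart {m q : ℕ} (φ : Covector (m + 1) q) : Covector m q :=
  φ.compContinuousLinearMap (incl m)

noncomputable def alphaPart {m q : ℕ} (φ : Covector (m + 1) (q + 1)) : Covector m q :=
  (φ.curryLeft (EuclideanSpace.single 0 1)).compContinuousLinearMap (incl m)

lemma betaPart_apply {m q : ℕ} (φ : Covector (m + 1) q) (v : Fin q → EuclideanSpace ℝ (Fin m)) :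
    betaPart φ v = φ (fun i => incl m (v i)) := rfl

lemma alphaPart_apply {m q : ℕ} (φ : Covector (m + 1) (q + 1))
    (v : Fin q → EuclideanSpace ℝ (Fin m)) :
    alphaPart φ v = φ (Fin.cons (EuclideanSpace.single 0 1) (fun i => incl m (v i))) := rfl

/-- Strictly increasing multi-indices, split by whether they contain `0`. -/
def splitMap (m q : ℕ) : {f : Fin q → Fin m // StrictMono f} ⊕
    {f : Fin (q + 1) → Fin m // StrictMono f} →
    {f : Fin (q + 1) → Fin (m + 1) // StrictMono f} :=
  Sum.elim
    (fun g => ⟨Fin.cons 0 (fun i => (g.1 i).succ), by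
      intro i j
      refine Fin.cases ?_ (fun k => ?_) i <;> refine Fin.cases ?_ (fun l => ?_) j
      · simp
      · simp
      · simp
      · intro h
        simpa using g.2 (Fin.succ_lt_succ_iff.1 h)⟩)
    (fun g => ⟨fun i => (g.1 i).succ, fun i j h => Fin.succ_lt_succ_iff.2 (g.2 h)⟩)

lemma splitMap_bij (m q : ℕ) : Function.Bijective (splitMap m q) := by
  constructor
  · rintro (⟨a, ha⟩ | ⟨a, ha⟩) (⟨b, hb⟩ | ⟨b, hb⟩) h
    · have h' := congrArg Subtype.val h
      simp only [splitMap, Sum.elim_inl] at h'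
      congr 2
      funext i
      simpa using congrFun h' i.succ
    · have h' := congrFun (congrArg Subtype.val h) 0
      simp [splitMap] at h'
      exact absurd h'.symm (Fin.succ_ne_zero _)
    · have h' := congrFun (congrArg Subtype.val h) 0
      simp [splitMap] at h'
    · have h' := congrArg Subtype.val h
      simp only [splitMap, Sum.elim_inr] at h'
      congr 2
      funext i
      simpa using congrFun h' i
  · rintro ⟨f, hf⟩
    have hs : ∀ i : Fin q, f i.succ ≠ 0 := fun i =>
      Fin.pos_iff_ne_zero.1 (lt_of_le_of_lt (Fin.zero_le _) (hf (Fin.succ_pos i)))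
    by_cases h0 : f 0 = 0
    · refine ⟨Sum.inl ⟨fun i => (f i.succ).pred (hs i), ?_⟩, ?_⟩
      · intro i j h
        exact Fin.pred_lt_pred_iff.2 (hf (Fin.succ_lt_succ_iff.2 h))
      · apply Subtype.ext
        funext i
        refine Fin.cases ?_ (fun k => ?_) i
        · simp [splitMap, h0]
        · simp [splitMap]
    · have ha : ∀ i, f i ≠ 0 := fun i => Fin.cases h0 hs i
      refine ⟨Sum.inr ⟨fun i => (f i).pred (ha i), ?_⟩, ?_⟩
      · intro i j h
        exact Fin.pred_lt_pred_iff.2 (hf h)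
      · apply Subtype.ext
        funext i
        simp [splitMap]

lemma euclNorm_split {m q : ℕ} (φ : Covector (m + 1) (q + 1)) :
    euclNorm φ ^ 2 = euclNorm (alphaPart φ) ^ 2 + euclNorm (betaPart φ) ^ 2 := by
  rw [euclNorm_sq, euclNorm_sq, euclNorm_sq,
    ← (Equiv.ofBijective _ (splitMap_bij m q)).sum_comp, Fintype.sum_sum_type]
  congr 1
  · refine Finset.sum_congr rfl fun g _ => ?_
    rw [alphaPart_apply]
    congr 2
    funext i
    refine Fin.cases ?_ (fun k => ?_) i
    · simp [splitMap]
    · simp [splitMap, incl_single]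
  · refine Finset.sum_congr rfl fun g _ => ?_
    rw [betaPart_apply]
    congr 2
    funext i
    simp [splitMap, incl_single]

lemma const_step (m q : ℕ) : normComparisonConst (m + 1) (q + 1) ^ 2 ≤
    normComparisonConst m q ^ 2 + normComparisonConst m (q + 1) ^ 2 := by
  refine (Real.le_sqrt (const_nonneg _ _) (by positivity)).1 ?_
  apply Real.sSup_le _ (Real.sqrt_nonneg _)
  rintro r ⟨φ, h, rfl⟩
  have hp := comass_pos φ h
  have ha : comass (alphaPart φ) ≤ comass φ := comass_le _ hp.le fun v hv => by
    rw [alphaPart_apply]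
    exact le_comass φ (cons_orthonormal hv)
  have hb : comass (betaPart φ) ≤ comass φ := comass_le _ hp.le fun v hv => by
    rw [betaPart_apply]
    exact le_comass φ (incl_orthonormal hv)
  have ea := (euclNorm_le (alphaPart φ)).trans
    (mul_le_mul_of_nonneg_left ha (const_nonneg _ _))
  have eb := (euclNorm_le (betaPart φ)).trans
    (mul_le_mul_of_nonneg_left hb (const_nonneg _ _))
  apply Real.le_sqrt_of_sq_le
  rw [div_pow, div_le_iff₀ (by positivity), euclNorm_split, add_mul, ← mul_pow, ← mul_pow]
  exact add_le_add (pow_le_pow_left₀ (Real.sqrt_nonneg _) ea 2)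
    (pow_le_pow_left₀ (Real.sqrt_nonneg _) eb 2)

/-- Proposition 2.3: for `1 < p < n-1`, `C_{n,p}² ≤ C_{n-1,p-1}² + C_{n-1,p}²`. -/
theorem comass_const_sq_le_add (n p : ℕ) (h1 : 1 < p) (h2 : p < n - 1) :
    normComparisonConst n p ^ 2 ≤
      normComparisonConst (n - 1) (p - 1) ^ 2 + normComparisonConst (n - 1) p ^ 2 := by
  obtain ⟨m, rfl⟩ : ∃ m, n = m + 1 := ⟨n - 1, by omega⟩
  obtain ⟨q, rfl⟩ : ∃ q, p = q + 1 := ⟨p - 1, by omega⟩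
  exact const_step m q
end

section
/- For all integers n ≥ 2 and 1 ≤ p ≤ n-1, the norm-comparison constant satisfies C_{n,p}² ≤ C(n-2, p-1), the binomial coefficient n-2 choose p-1. -/
open scoped Classical

lemma aux_sum_le {α β : Type*} [Fintype α] [Fintype β] (T : α → β) (hT : Function.Surjective T)
    (F : β → ℝ) (hF : ∀ b, 0 ≤ F b) : ∑ b, F b ≤ ∑ a, F (T a) := by
  obtain ⟨g, hg⟩ := hT.hasRightInverse
  calc ∑ b, F b = ∑ b, F (T (g b)) := by simp [hg _]
    _ = ∑ a ∈ Finset.univ.map ⟨g, hg.injective⟩, F (T a) := by simp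
    _ ≤ ∑ a, F (T a) :=
      Finset.sum_le_sum_of_subset_of_nonneg (Finset.subset_univ _) (fun _ _ _ => hF _)

/-- Pascal decomposition of sums over strictly increasing indices. -/
lemma aux_pascal {q m : ℕ} (F : (Fin (q + 1) → Fin (m + 1)) → ℝ) (hF : ∀ f, 0 ≤ F f) :
    ∑ f : {f : Fin (q + 1) → Fin (m + 1) // StrictMono f}, F f.1 ≤
      (∑ g : {g : Fin q → Fin m // StrictMono g}, F (Fin.cons 0 (fun i => (g.1 i).succ))) +
      ∑ g : {g : Fin (q + 1) → Fin m // StrictMono g}, F (fun i => (g.1 i).succ) := by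
  let T : {g : Fin q → Fin m // StrictMono g} ⊕ {g : Fin (q + 1) → Fin m // StrictMono g} →
      {f : Fin (q + 1) → Fin (m + 1) // StrictMono f} := fun x => match x with
    | .inl g => ⟨Fin.cons 0 (fun i => (g.1 i).succ), by
        intro i j hij
        induction j using Fin.cases with
        | zero => simp at hij
        | succ j =>
          induction i using Fin.cases with
          | zero => simp
          | succ i => simpa using g.2 (Fin.succ_lt_succ_iff.1 hij)⟩
    | .inr g => ⟨fun i => (g.1 i).succ, fun i j hij => Fin.succ_lt_succ_iff.2 (g.2 hij)⟩
  have hT : Function.Surjective T := by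
    rintro ⟨f, hf⟩
    by_cases h0 : f 0 = 0
    · have hne : ∀ i : Fin q, f i.succ ≠ 0 := fun i h => by
        have := hf (Fin.succ_pos i)
        rw [h] at this
        simp at this
      refine ⟨.inl ⟨fun i => (f i.succ).pred (hne i), fun i j hij => ?_⟩, ?_⟩
      · exact Fin.pred_lt_pred_iff.2 (hf (Fin.succ_lt_succ_iff.2 hij))
      · apply Subtype.ext
        funext i
        induction i using Fin.cases with
        | zero => simp [T, h0]
        | succ i => simp [T]
    · have hne : ∀ i, f i ≠ 0 := fun i h => by
        have := hf.monotone (Fin.zero_le i)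
        rw [h] at this
        exact h0 (by simpa using this)
      refine ⟨.inr ⟨fun i => (f i).pred (hne i), fun i j hij => ?_⟩, ?_⟩
      · exact Fin.pred_lt_pred_iff.2 (hf hij)
      · apply Subtype.ext
        funext i
        simp [T]
  have := aux_sum_le T hT (fun f => F f.1) (fun f => hF _)
  rw [Fintype.sum_sum_type] at this
  exact this

/-- The case of codimension one in Euclidean space. -/
lemma aux_codim_one {q : ℕ} (φ : EuclideanSpace ℝ (Fin (q + 2)) [⋀^Fin (q + 1)]→ₗ[ℝ] ℝ) (M : ℝ)
    (hM : ∀ v, Orthonormal ℝ v → |φ v| ≤ M) :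
    ∑ f : {f : Fin (q + 1) → Fin (q + 2) // StrictMono f},
      (φ (fun i => EuclideanSpace.single (f.1 i) 1)) ^ 2 ≤ M ^ 2 := by
  set e := EuclideanSpace.basisFun (Fin (q + 2)) ℝ with he
  have hes : ∀ i, e i = EuclideanSpace.single i 1 := fun i => by simp [he]
  let D := e.toBasis.det
  let s : Fin (q + 2) → ℝ := fun i => D (Fin.cons (e i) (fun j => e (i.succAbove j)))
  have habs : ∀ v : Fin (q + 2) → EuclideanSpace ℝ (Fin (q + 2)), Orthonormal ℝ v →
      |D v| = 1 := by
    intro v hv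
    let u := (basisOfOrthonormalOfCardEqFinrank hv (by simp)).toOrthonormalBasis (by simpa using hv)
    have hu : (u : Fin (q + 2) → _) = v := by simp [u]
    have h2 := e.det_to_matrix_orthonormalBasis_real u
    rw [hu] at h2
    have h3 : D v = 1 ∨ D v = -1 := h2
    rcases h3 with h | h <;> simp [h]
  have hs : ∀ i, s i ^ 2 = 1 := by
    intro i
    have : |s i| = 1 := by
      apply habs
      have : (Fin.cons (e i) (fun j => e (i.succAbove j)) : Fin (q + 2) → _) =
          e ∘ (Fin.cons i i.succAbove : Fin (q + 2) → Fin (q + 2)) := by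
        funext j
        induction j using Fin.cases <;> simp
      rw [this]
      apply e.orthonormal.comp
      rw [Fin.cons_injective_iff]
      exact ⟨by simp [Fin.range_succAbove], Fin.succAbove_right_injective⟩
    rw [← sq_abs, this, one_pow]
  let a : Fin (q + 2) → ℝ := fun i => φ (fun j => e (i.succAbove j))
  let c : EuclideanSpace ℝ (Fin (q + 2)) := ∑ i, (a i * s i) • e i
  have hφ : φ = D.curryLeft c := by
    apply e.toBasis.ext_alternating
    intro v hv
    have hns : ¬ Function.Surjective v := by
      intro h
      have := Fintype.card_le_of_surjective v h
      simp at this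
    simp only [Function.Surjective, not_forall, not_exists] at hns
    obtain ⟨i, hi⟩ := hns
    have hex : ∀ j, ∃ k, i.succAbove k = v j := fun j => Fin.exists_succAbove_eq (hi j)
    choose σ hσ using hex
    have hσi : Function.Injective σ := by
      intro j k hjk
      apply hv
      rw [← hσ, ← hσ, hjk]
    let τ : Equiv.Perm (Fin (q + 1)) :=
      Equiv.ofBijective σ (Finite.injective_iff_bijective.1 hσi)
    have hv' : (fun j => e.toBasis (v j)) = (fun j => e (i.succAbove j)) ∘ τ := by
      funext j
      simp [τ, hσ]
    rw [hv']
    rw [φ.map_perm, (D.curryLeft c).map_perm]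
    congr 1
    have hcurry : ∀ w, D.curryLeft c w =
        ∑ i, (a i * s i) * D (Fin.cons (e i) w) := by
      intro w
      have : ∀ x, D.curryLeft x w = D.toMultilinearMap.curryLeft x w := fun x => rfl
      rw [this]
      simp only [c, map_sum, map_smul, sum_apply, smul_apply,
        smul_eq_mul]
      rfl
    rw [hcurry]
    rw [Finset.sum_eq_single i]
    · change a i = (a i * s i) * s i
      have := hs i
      linear_combination (-a i) * this
    · intro k _ hk
      obtain ⟨l, rfl⟩ := Fin.exists_succAbove_eq hk
      rw [D.map_eq_zero_of_eq (i := 0) (j := l.succ) _ (by simp)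
        (Fin.succ_ne_zero l).symm]
      simp
    · simp
  have hsum : ∑ f : {f : Fin (q + 1) → Fin (q + 2) // StrictMono f},
      (φ (fun i => EuclideanSpace.single (f.1 i) 1)) ^ 2 ≤ ∑ i, a i ^ 2 := by
    have hT : Function.Surjective (fun i : Fin (q + 2) =>
        (⟨i.succAbove, Fin.strictMono_succAbove i⟩ :
          {f : Fin (q + 1) → Fin (q + 2) // StrictMono f})) := by
      rintro ⟨f, hf⟩
      have hns : ¬ Function.Surjective f := by
        intro h
        have := Fintype.card_le_of_surjective f h
        simp at this
      simp only [Function.Surjective, not_forall, not_exists] at hns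
      obtain ⟨i, hi⟩ := hns
      refine ⟨i, Subtype.ext ?_⟩
      apply ((Fin.strictMono_succAbove i).range_inj hf).1
      rw [Fin.range_succAbove]
      symm
      apply Set.eq_of_subset_of_ncard_le
      · rintro _ ⟨j, rfl⟩
        exact hi j
      rotate_left
      · exact Set.toFinite _
      · rw [Set.ncard_compl, ← Set.image_univ, Set.ncard_image_of_injective _ hf.injective]
        simp
    have := aux_sum_le _ hT
      (fun f => (φ (fun i => EuclideanSpace.single (f.1 i) 1)) ^ 2) (fun f => sq_nonneg _)
    refine this.trans (le_of_eq ?_)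
    simp [a, hes]
  refine hsum.trans ?_
  have hc : ‖c‖ ^ 2 = ∑ i, a i ^ 2 := by
    rw [← real_inner_self_eq_norm_sq, e.orthonormal.inner_sum]
    refine Finset.sum_congr rfl fun i _ => ?_
    have := hs i
    simp only [conj_trivial]
    linear_combination (a i ^ 2) * this
  rw [← hc]
  by_cases hc0 : c = 0
  · rw [hc0]; simp; positivity
  have hn0 : ‖c‖ ≠ 0 := norm_ne_zero_iff.2 hc0
  obtain ⟨u, hu⟩ := Orthonormal.exists_orthonormalBasis_extension_of_card_eq (𝕜 := ℝ)
    (E := EuclideanSpace ℝ (Fin (q + 2))) (ι := Fin (q + 2)) (by simp)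
    (v := fun _ => ‖c‖⁻¹ • c) (s := {0}) (by
      rw [orthonormal_iff_ite]
      rintro ⟨i, hi⟩ ⟨j, hj⟩
      simp at hi hj
      subst hi; subst hj
      simp [norm_smul, hn0])
  have hu0 := hu 0 (by simp)
  have h1 := hM (fun j => u j.succ) (u.orthonormal.comp _ (Fin.succ_injective _))
  have h2 : D.curryLeft c (fun j => u j.succ) = ‖c‖ * D u := by
    have : c = ‖c‖ • u 0 := by
      rw [hu0, smul_smul, mul_inv_cancel₀ hn0, one_smul]
    conv_lhs => rw [this]
    rw [map_smul, AlternatingMap.smul_apply, AlternatingMap.curryLeft_apply_apply, smul_eq_mul]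
    congr 2
    funext j
    induction j using Fin.cases <;> simp
  rw [hφ, h2, abs_mul, habs _ u.orthonormal, mul_one, abs_norm] at h1
  gcongr

/-- The case of one-forms. -/
lemma aux_one {E : Type*} [NormedAddCommGroup E] [InnerProductSpace ℝ E] (M : ℝ)
    (n : ℕ) (b : Fin n → E) (hb : Orthonormal ℝ b) (φ : E [⋀^Fin 1]→ₗ[ℝ] ℝ)
    (hM : ∀ v, Orthonormal ℝ v → (∀ i, v i ∈ Submodule.span ℝ (Set.range b)) → |φ v| ≤ M) :
    ∑ f : {f : Fin 1 → Fin n // StrictMono f}, (φ (fun i => b (f.1 i))) ^ 2 ≤ M ^ 2 := by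
  let L : E →ₗ[ℝ] ℝ := (AlternatingMap.ofSubsingleton ℝ E ℝ (0 : Fin 1)).symm φ
  have hL : ∀ x, L x = φ (fun _ => x) := fun x => rfl
  have hT : Function.Surjective (fun i : Fin n =>
      (⟨fun _ => i, fun j k hjk => absurd hjk (by simp [Subsingleton.elim j k])⟩ :
        {f : Fin 1 → Fin n // StrictMono f})) := by
    rintro ⟨f, hf⟩
    refine ⟨f 0, Subtype.ext ?_⟩
    funext i
    rw [Subsingleton.elim i 0]
  refine (aux_sum_le _ hT (fun f => (φ (fun i => b (f.1 i))) ^ 2) (fun _ => sq_nonneg _)).trans ?_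
  change ∑ i, L (b i) ^ 2 ≤ M ^ 2
  let w : E := ∑ i, L (b i) • b i
  have hw : ‖w‖ ^ 2 = ∑ i, L (b i) ^ 2 := by
    rw [← real_inner_self_eq_norm_sq, hb.inner_sum]
    refine Finset.sum_congr rfl fun i _ => ?_
    simp only [conj_trivial]
    ring
  have hLw : L w = ‖w‖ ^ 2 := by
    rw [hw]
    simp only [w, map_sum, map_smul, smul_eq_mul]
    exact Finset.sum_congr rfl fun i _ => by ring
  rw [← hw]
  by_cases hw0 : w = 0
  · rw [hw0]; simp; positivity
  have hn0 : ‖w‖ ≠ 0 := norm_ne_zero_iff.2 hw0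
  have hwm : w ∈ Submodule.span ℝ (Set.range b) :=
    Submodule.sum_mem _ fun i _ => Submodule.smul_mem _ _ (Submodule.subset_span ⟨i, rfl⟩)
  have h1 := hM (fun _ => ‖w‖⁻¹ • w) (by
      rw [orthonormal_iff_ite]
      intro i j
      rw [Subsingleton.elim i j]
      simp [norm_smul, hn0]) (fun _ => Submodule.smul_mem _ _ hwm)
  rw [← hL, map_smul, hLw, smul_eq_mul, pow_two, inv_mul_cancel_left₀ hn0, abs_norm] at h1
  gcongr

lemma aux_codim_one_gen {E : Type*} [NormedAddCommGroup E] [InnerProductSpace ℝ E] (M : ℝ)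
    (q : ℕ) (b : Fin (q + 2) → E) (hb : Orthonormal ℝ b) (φ : E [⋀^Fin (q + 1)]→ₗ[ℝ] ℝ)
    (hM : ∀ v, Orthonormal ℝ v → (∀ i, v i ∈ Submodule.span ℝ (Set.range b)) → |φ v| ≤ M) :
    ∑ f : {f : Fin (q + 1) → Fin (q + 2) // StrictMono f}, (φ (fun i => b (f.1 i))) ^ 2
      ≤ M ^ 2 := by
  let e := EuclideanSpace.basisFun (Fin (q + 2)) ℝ
  let L : EuclideanSpace ℝ (Fin (q + 2)) →ₗ[ℝ] E := e.toBasis.constr ℝ b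
  have hLe : ∀ i, L (EuclideanSpace.single i 1) = b i := fun i => by
    have h1 : L (e.toBasis i) = b i := e.toBasis.constr_basis ℝ b i
    have h2 : e.toBasis i = EuclideanSpace.single i 1 := by simp [e]
    rwa [h2] at h1
  let L' : EuclideanSpace ℝ (Fin (q + 2)) →ₗᵢ[ℝ] E := L.isometryOfOrthonormal (v := e.toBasis)
    (by simpa using e.orthonormal) (by
      have : L ∘ e.toBasis = b := by
        funext i
        exact e.toBasis.constr_basis ℝ b i
      rw [this]; exact hb)
  have hmem : ∀ x, L x ∈ Submodule.span ℝ (Set.range b) := fun x => by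
    rw [← e.toBasis.constr_range (S := ℝ)]
    exact ⟨x, rfl⟩
  have := aux_codim_one (φ.compLinearMap L) M (fun v hv => by
    exact hM (fun i => L (v i)) (hv.comp_linearIsometry L') (fun i => hmem _))
  refine le_trans (le_of_eq ?_) this
  simp [hLe, Function.comp_def]

lemma aux_main {E : Type*} [NormedAddCommGroup E] [InnerProductSpace ℝ E] (M : ℝ) :
    ∀ (n q k : ℕ), n = q + k + 2 → ∀ (b : Fin n → E), Orthonormal ℝ b →
    ∀ φ : E [⋀^Fin (q + 1)]→ₗ[ℝ] ℝ,
    (∀ v, Orthonormal ℝ v → (∀ i, v i ∈ Submodule.span ℝ (Set.range b)) → |φ v| ≤ M) →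
    ∑ f : {f : Fin (q + 1) → Fin n // StrictMono f},
      (φ (fun i => b (f.1 i))) ^ 2 ≤ ((q + k).choose q : ℝ) * M ^ 2 := by
  intro n
  induction n with
  | zero => intro q k h; omega
  | succ n ih =>
    intro q k hn b hb φ hM
    rcases q with _ | q
    · simpa using aux_one M _ b hb φ hM
    rcases k with _ | k
    · obtain rfl : n = q + 2 := by omega
      simpa using aux_codim_one_gen M _ b hb φ hM
    have hb' : Orthonormal ℝ (fun i : Fin n => b i.succ) := hb.comp _ (Fin.succ_injective _)
    have hsub : Submodule.span ℝ (Set.range fun i : Fin n => b i.succ) ≤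
        Submodule.span ℝ (Set.range b) := by
      apply Submodule.span_mono
      rintro _ ⟨i, rfl⟩
      exact ⟨i.succ, rfl⟩
    have hperp : ∀ x ∈ Submodule.span ℝ (Set.range fun i : Fin n => b i.succ),
        inner ℝ (b 0) x = 0 := by
      intro x hx
      induction hx using Submodule.span_induction with
      | mem x h =>
        obtain ⟨i, rfl⟩ := h
        exact hb.2 (Fin.succ_ne_zero i).symm
      | zero => simp
      | add x y _ _ hx hy => rw [inner_add_right, hx, hy, add_zero]
      | smul a x _ hx => rw [inner_smul_right, hx, mul_zero]
    have hA := ih q (k + 1) (by omega) _ hb' (φ.curryLeft (b 0)) (by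
      intro v hv hvm
      refine hM (Fin.cons (b 0) v) ?_ ?_
      · constructor
        · intro i
          induction i using Fin.cases with
          | zero => exact hb.1 0
          | succ i => exact hv.1 i
        · intro i j hij
          induction i using Fin.cases with
          | zero =>
            induction j using Fin.cases with
            | zero => exact absurd rfl hij
            | succ j => exact hperp _ (hvm j)
          | succ i =>
            induction j using Fin.cases with
            | zero =>
              rw [real_inner_comm]
              exact hperp _ (hvm i)
            | succ j =>
              have hne : i ≠ j := fun h => hij (by rw [h])
              exact hv.2 hne
      · intro i
        induction i using Fin.cases with
        | zero => exact Submodule.subset_span ⟨0, rfl⟩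
        | succ i => exact hsub (hvm i))
    have hB := ih (q + 1) k (by omega) _ hb' φ (fun v hv hvm => hM v hv fun i => hsub (hvm i))
    refine (aux_pascal (fun f => (φ (fun i => b (f i))) ^ 2) (fun _ => sq_nonneg _)).trans ?_
    have hch : ((q + 1 + (k + 1)).choose (q + 1) : ℝ) =
        (q + (k + 1)).choose q + (q + 1 + k).choose (q + 1) := by
      have h1 : q + 1 + (k + 1) = (q + 1 + k) + 1 := by omega
      have h2 : q + (k + 1) = q + 1 + k := by omega
      rw [h1, h2, Nat.choose_succ_succ]
      push_cast
      ring
    rw [hch, add_mul]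
    refine add_le_add (le_trans (le_of_eq ?_) hA) hB
    refine Finset.sum_congr rfl fun g _ => ?_
    rw [AlternatingMap.curryLeft_apply_apply]
    congr 2
    funext i
    induction i using Fin.cases <;> simp

/-- Corollary 2.4: `C_{n,p}² ≤ binom(n-2, p-1)`. -/
theorem comass_const_sq_le_choose (n p : ℕ) (hn : 2 ≤ n) (h1 : 1 ≤ p) (h2 : p ≤ n - 1) :
    normComparisonConst n p ^ 2 ≤ ((n - 2).choose (p - 1) : ℝ) := by
  obtain ⟨q, rfl⟩ : ∃ q, p = q + 1 := ⟨p - 1, by omega⟩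
  obtain ⟨k, rfl⟩ : ∃ k, n = q + k + 2 := ⟨n - 2 - q, by omega⟩
  simp only [Nat.add_sub_cancel]
  have key : ∀ φ : Covector (q + k + 2) (q + 1), euclNorm φ / comass φ ≤
      Real.sqrt ((q + k).choose q) := by
    intro φ
    have hbdd : BddAbove {r : ℝ | ∃ v : Fin (q + 1) → EuclideanSpace ℝ (Fin (q + k + 2)),
        Orthonormal ℝ v ∧ r = |φ v|} := by
      refine ⟨‖φ‖, ?_⟩
      rintro _ ⟨v, hv, rfl⟩
      have := φ.le_opNorm v
      simpa [hv.1] using this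
    have hle : ∀ v, Orthonormal ℝ v → |φ v| ≤ comass φ := fun v hv =>
      le_csSup hbdd ⟨v, hv, rfl⟩
    have h0 : 0 ≤ comass φ := by
      apply Real.sSup_nonneg
      rintro _ ⟨v, hv, rfl⟩
      positivity
    have := aux_main (comass φ) _ q k rfl (EuclideanSpace.basisFun (Fin (q + k + 2)) ℝ)
      (OrthonormalBasis.orthonormal _) φ.toAlternatingMap (fun v hv _ => hle v hv)
    apply div_le_of_le_mul₀ h0 (Real.sqrt_nonneg _)
    unfold euclNorm
    rw [← Real.sqrt_sq h0, ← Real.sqrt_mul (by positivity)]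
    apply Real.sqrt_le_sqrt
    simpa using this
  have hnn : 0 ≤ normComparisonConst (q + k + 2) (q + 1) := by
    apply Real.sSup_nonneg
    rintro _ ⟨φ, -, rfl⟩
    apply div_nonneg (Real.sqrt_nonneg _)
    apply Real.sSup_nonneg
    rintro _ ⟨v, hv, rfl⟩
    positivity
  have hle : normComparisonConst (q + k + 2) (q + 1) ≤ Real.sqrt ((q + k).choose q) := by
    apply Real.sSup_le _ (Real.sqrt_nonneg _)
    rintro _ ⟨φ, -, rfl⟩
    exact key φ
  calc _ ≤ Real.sqrt ((q + k).choose q) ^ 2 := by gcongr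
    _ = _ := Real.sq_sqrt (by positivity)
end

section
/- The norm-comparison constant C_{6,3} equals 2; that is, every nonzero 3-covector φ on ℝ⁶ satisfies |φ|* ≤ 2‖φ‖*, and there exists a nonzero 3-covector φ on ℝ⁶ with |φ|* = 2‖φ‖*. -/
open scoped Classical

namespace C63

abbrev E6 := EuclideanSpace ℝ (Fin 6)

lemma comass_bdd (φ : Covector 6 3) : BddAbove {r : ℝ | ∃ v : Fin 3 → EuclideanSpace ℝ (Fin 6),
    Orthonormal ℝ v ∧ r = |φ v|} := by
  refine ⟨‖φ‖, ?_⟩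
  rintro r ⟨v, hv, rfl⟩
  have h := φ.le_opNorm v
  simpa [hv.1] using h

lemma le_comass (φ : Covector 6 3) (v : Fin 3 → E6) (hv : Orthonormal ℝ v) : |φ v| ≤ comass φ :=
  le_csSup (comass_bdd φ) ⟨v, hv, rfl⟩

lemma comass_nonneg (φ : Covector 6 3) : 0 ≤ comass φ := by
  apply Real.sSup_nonneg
  rintro r ⟨v, hv, rfl⟩
  positivity

/-- A skew-symmetric real `5 × 5` matrix has large operator norm. -/
lemma skew5 (M : Matrix (Fin 5) (Fin 5) ℝ) (hM : M.transpose = -M) :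
    ∃ u : Fin 5 → ℝ, u ⬝ᵥ u = 1 ∧ ∑ j, ∑ k, M j k ^ 2 ≤ 4 * (M.mulVec u ⬝ᵥ M.mulVec u) := by
  have hdet : M.det = 0 := by
    have h := M.det_transpose
    rw [hM, Matrix.det_neg] at h
    simp at h
    norm_num at h
    linarith
  have hP : (M.transpose * M).PosSemidef := by
    simpa using Matrix.posSemidef_conjTranspose_mul_self M
  have hH := hP.isHermitian
  have htr : ∑ i, hH.eigenvalues i = ∑ j, ∑ k, M j k ^ 2 := by
    have h := hH.trace_eq_sum_eigenvalues
    simp only [RCLike.ofReal_real_eq_id, id] at h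
    rw [← h, Finset.sum_comm]
    simp [Matrix.trace, Matrix.mul_apply, pow_two]
  have hprod : ∏ i, hH.eigenvalues i = 0 := by
    have h := hH.det_eq_prod_eigenvalues
    simp only [RCLike.ofReal_real_eq_id, id] at h
    rw [← h, Matrix.det_mul, hdet, mul_zero]
  obtain ⟨i0, -, hi0⟩ := Finset.prod_eq_zero_iff.1 hprod
  have hex : ∃ i, ∑ j, ∑ k, M j k ^ 2 ≤ 4 * hH.eigenvalues i := by
    by_contra! hcon
    have h1 : ∑ i ∈ Finset.univ.erase i0, hH.eigenvalues i
        < ∑ i ∈ Finset.univ.erase i0, (∑ j, ∑ k, M j k ^ 2) / 4 := by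
      apply Finset.sum_lt_sum_of_nonempty
      · rw [← Finset.card_pos]; simp
      · intro i _
        linarith [hcon i]
    have h2 := Finset.add_sum_erase Finset.univ hH.eigenvalues (Finset.mem_univ i0)
    simp at h1
    rw [hi0, htr] at h2
    linarith
  obtain ⟨i, hi⟩ := hex
  refine ⟨(hH.eigenvectorBasis i).ofLp, ?_, ?_⟩
  · have h := hH.eigenvectorBasis.orthonormal.1 i
    have h2 : ‖hH.eigenvectorBasis i‖ ^ 2 = 1 := by rw [h]; norm_num
    rw [EuclideanSpace.real_norm_sq_eq] at h2
    simpa [dotProduct, pow_two] using h2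
  · have h := hH.mulVec_eigenvectorBasis i
    have hu : (hH.eigenvectorBasis i).ofLp ⬝ᵥ (hH.eigenvectorBasis i).ofLp = 1 := by
      have h := hH.eigenvectorBasis.orthonormal.1 i
      have h2 : ‖hH.eigenvectorBasis i‖ ^ 2 = 1 := by rw [h]; norm_num
      rw [EuclideanSpace.real_norm_sq_eq] at h2
      simpa [dotProduct, pow_two] using h2
    have key : M.mulVec (hH.eigenvectorBasis i).ofLp ⬝ᵥ M.mulVec (hH.eigenvectorBasis i).ofLp
        = hH.eigenvalues i := by
      rw [Matrix.dotProduct_mulVec, Matrix.vecMul_mulVec, ← Matrix.mulVec_transpose]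
      simp only [Matrix.transpose_mul, Matrix.transpose_transpose]
      rw [h, smul_dotProduct, hu]
      simp
    rw [key]; exact hi

noncomputable def emb (i : Fin 6) (u : Fin 5 → ℝ) : E6 :=
  ∑ j, u j • EuclideanSpace.single (i.succAbove j) (1 : ℝ)

noncomputable def co (φ : Covector 6 3) (i j k : Fin 6) : ℝ :=
  φ ![EuclideanSpace.single i 1, EuclideanSpace.single j 1, EuclideanSpace.single k 1]

lemma emb_same (i : Fin 6) (u : Fin 5 → ℝ) : emb i u i = 0 := by
  simp [emb, Fin.ne_succAbove]

lemma emb_succ (i : Fin 6) (u : Fin 5 → ℝ) (j : Fin 5) : emb i u (i.succAbove j) = u j := by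
  simp [emb, Pi.single_apply]

lemma inner_emb (i : Fin 6) (u w : Fin 5 → ℝ) : inner ℝ (emb i u) (emb i w) = u ⬝ᵥ w := by
  rw [PiLp.inner_apply, Fin.sum_univ_succAbove _ i]
  simp [emb_same, emb_succ, dotProduct, mul_comm]

lemma inner_single_emb (i : Fin 6) (u : Fin 5 → ℝ) :
    inner ℝ (EuclideanSpace.single i (1 : ℝ)) (emb i u) = 0 := by
  rw [EuclideanSpace.inner_single_left, emb_same, mul_zero]

lemma phi_sum_two (φ : Covector 6 3) (x z : E6) (w : Fin 5 → ℝ) (b : Fin 5 → E6) :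
    φ ![x, ∑ j, w j • b j, z] = ∑ j, w j * φ ![x, b j, z] := by
  have h := map_sum (φ.toMultilinearMap.toLinearMap ![x, 0, z] 1) (fun j => w j • b j) Finset.univ
  simp only [LinearMap.map_smul] at h
  have hu : ∀ y : E6, (φ.toMultilinearMap.toLinearMap ![x, 0, z] 1) y = φ ![x, y, z] := by
    intro y
    have : Function.update ![x, 0, z] 1 y = ![x, y, z] := by
      ext a; fin_cases a <;> rfl
    simp [MultilinearMap.toLinearMap, this]
  simpa [hu] using h

lemma phi_sum_three (φ : Covector 6 3) (x y : E6) (w : Fin 5 → ℝ) (b : Fin 5 → E6) :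
    φ ![x, y, ∑ j, w j • b j] = ∑ j, w j * φ ![x, y, b j] := by
  have h := map_sum (φ.toMultilinearMap.toLinearMap ![x, y, 0] 2) (fun j => w j • b j) Finset.univ
  simp only [LinearMap.map_smul] at h
  have hu : ∀ z : E6, (φ.toMultilinearMap.toLinearMap ![x, y, 0] 2) z = φ ![x, y, z] := by
    intro z
    have : Function.update ![x, y, 0] 2 z = ![x, y, z] := by
      ext a; fin_cases a <;> rfl
    simp [MultilinearMap.toLinearMap, this]
  simpa [hu] using h

lemma phi_emb (φ : Covector 6 3) (i : Fin 6) (w u : Fin 5 → ℝ) :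
    φ ![EuclideanSpace.single i 1, emb i w, emb i u] =
      w ⬝ᵥ (Matrix.of fun j k => co φ i (i.succAbove j) (i.succAbove k)).mulVec u := by
  unfold emb
  rw [phi_sum_two]
  simp only [phi_sum_three]
  simp [dotProduct, Matrix.mulVec, co, mul_comm]

lemma co_swap1 (φ : Covector 6 3) (i j k : Fin 6) : co φ j i k = - co φ i j k := by
  have h := φ.toAlternatingMap.map_swap ![EuclideanSpace.single i 1, EuclideanSpace.single j 1,
    EuclideanSpace.single k 1] (i := 0) (j := 1) (by decide)
  unfold co
  rw [← ContinuousAlternatingMap.coe_toAlternatingMap, ← h]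
  congr 1
  ext a; fin_cases a <;> rfl

lemma co_swap2 (φ : Covector 6 3) (i j k : Fin 6) : co φ i k j = - co φ i j k := by
  have h := φ.toAlternatingMap.map_swap ![EuclideanSpace.single i 1, EuclideanSpace.single j 1,
    EuclideanSpace.single k 1] (i := 1) (j := 2) (by decide)
  unfold co
  rw [← ContinuousAlternatingMap.coe_toAlternatingMap, ← h]
  congr 1
  ext a; fin_cases a <;> rfl

lemma mulVec_le_comass (φ : Covector 6 3) (i : Fin 6) (M : Matrix (Fin 5) (Fin 5) ℝ)
    (hM : M = Matrix.of fun j k => co φ i (i.succAbove j) (i.succAbove k))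
    (u : Fin 5 → ℝ) (hu : u ⬝ᵥ u = 1) :
    M.mulVec u ⬝ᵥ M.mulVec u ≤ comass φ ^ 2 := by
  set w := M.mulVec u with hw
  set s := w ⬝ᵥ w with hs
  have hs0 : 0 ≤ s := by
    rw [hs, dotProduct]; exact Finset.sum_nonneg fun j _ => mul_self_nonneg _
  rcases hs0.eq_or_lt with h0 | hpos
  · rw [← h0]; positivity
  have hskew : M.transpose = -M := by
    ext j k
    simp [hM, co_swap2 φ i (i.succAbove j) (i.succAbove k)]
  have hwu : w ⬝ᵥ u = 0 := by
    have h1 : u ⬝ᵥ M.mulVec u = - (u ⬝ᵥ M.mulVec u) := by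
      conv_lhs => rw [Matrix.dotProduct_mulVec, ← Matrix.mulVec_transpose, hskew]
      rw [Matrix.neg_mulVec, neg_dotProduct, dotProduct_comm]
    rw [dotProduct_comm]
    linarith
  have hr : 0 < Real.sqrt s := Real.sqrt_pos.2 hpos
  have hrr : Real.sqrt s * Real.sqrt s = s := Real.mul_self_sqrt hs0
  set r := Real.sqrt s
  have horth : Orthonormal ℝ ![EuclideanSpace.single i (1 : ℝ), emb i (r⁻¹ • w), emb i u] := by
    rw [orthonormal_iff_ite]
    have e1 : inner ℝ (emb i (r⁻¹ • w)) (emb i (r⁻¹ • w)) = 1 := by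
      rw [inner_emb, smul_dotProduct, dotProduct_smul, ← hs, ← hrr]
      simp only [smul_eq_mul]
      field_simp
    have e2 : inner ℝ (emb i (r⁻¹ • w)) (emb i u) = 0 := by
      rw [inner_emb, smul_dotProduct, hwu]; simp
    have e3 : inner ℝ (emb i u) (emb i u) = 1 := by rw [inner_emb, hu]
    have e4 := inner_single_emb i (r⁻¹ • w)
    have e5 := inner_single_emb i u
    have e6 : inner ℝ (EuclideanSpace.single i (1 : ℝ)) (EuclideanSpace.single i (1 : ℝ)) = (1:ℝ) := by
      simp
    intro a b
    fin_cases a <;> fin_cases b <;>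
      simp only [Fin.zero_eta, Fin.mk_one, Fin.reduceFinMk, Matrix.cons_val]
    · rw [e6]; simp
    · rw [e4]; simp
    · rw [e5]; simp
    · rw [real_inner_comm, e4]; simp
    · rw [e1]; simp
    · rw [e2]; simp
    · rw [real_inner_comm, e5]; simp
    · rw [real_inner_comm, e2]; simp
    · rw [e3]; simp
  have hle := le_comass φ _ horth
  rw [phi_emb, ← hM, ← hw, smul_dotProduct, ← hs, ← hrr, smul_eq_mul] at hle
  have : r⁻¹ * (r * r) = r := by field_simp
  rw [this, abs_of_pos hr] at hle
  rw [← hrr, ← pow_two]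
  gcongr

lemma row_le (φ : Covector 6 3) (i : Fin 6) :
    ∑ j, ∑ k, co φ i j k ^ 2 ≤ 4 * comass φ ^ 2 := by
  have z1 : ∀ k, co φ i i k = 0 := fun k => by linarith [co_swap1 φ i i k]
  have z2 : ∀ j, co φ i j i = 0 := fun j => by rw [co_swap2, z1, neg_zero]
  have hskew : (Matrix.of fun j k => co φ i (i.succAbove j) (i.succAbove k)).transpose
      = - (Matrix.of fun j k => co φ i (i.succAbove j) (i.succAbove k)) := by
    ext j k
    simp [co_swap2 φ i (i.succAbove j) (i.succAbove k)]
  obtain ⟨u, hu, h⟩ := skew5 _ hskew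
  have h2 := mulVec_le_comass φ i _ rfl u hu
  have h3 : ∑ j, ∑ k, co φ i j k ^ 2 =
      ∑ j, ∑ k, co φ i (i.succAbove j) (i.succAbove k) ^ 2 := by
    rw [Fin.sum_univ_succAbove _ i]
    simp only [z1]
    simp only [Fin.sum_univ_succAbove (fun k => co φ i _ k ^ 2) i, z2]
    simp
  rw [h3]
  simp only [Matrix.of_apply] at h
  linarith

lemma sum_strictMono (g : (Fin 3 → Fin 6) → ℝ) :
    ∑ f : {f : Fin 3 → Fin 6 // StrictMono f}, g f.1 =
      ∑ i, ∑ j, ∑ k, if i < j ∧ j < k then g ![i, j, k] else 0 := by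
  let e : (Fin 3 → Fin 6) ≃ Fin 6 × Fin 6 × Fin 6 :=
    { toFun := fun f => (f 0, f 1, f 2)
      invFun := fun p => ![p.1, p.2.1, p.2.2]
      left_inv := fun f => by ext a; fin_cases a <;> rfl
      right_inv := fun p => rfl }
  have hm : ∀ i j k : Fin 6, StrictMono ![i, j, k] ↔ i < j ∧ j < k := by
    intro i j k
    rw [Fin.strictMono_iff_lt_succ]
    simp [Fin.forall_fin_two]
  rw [← Finset.sum_subtype (Finset.univ.filter fun f : Fin 3 → Fin 6 => StrictMono f)
    (by simp) g, Finset.sum_filter, ← e.symm.sum_comp, Fintype.sum_prod_type]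
  simp only [Fintype.sum_prod_type]
  refine Finset.sum_congr rfl fun i _ => Finset.sum_congr rfl fun j _ =>
    Finset.sum_congr rfl fun k _ => ?_
  have he : e.symm (i, j, k) = ![i, j, k] := rfl
  rw [he]
  simp only [hm]

lemma sum_all (T : Fin 6 → Fin 6 → Fin 6 → ℝ) (h1 : ∀ i j k, T j i k = T i j k)
    (h2 : ∀ i j k, T i k j = T i j k) (h0 : ∀ i k, T i i k = 0) :
    ∑ i, ∑ j, ∑ k, T i j k = 6 * ∑ i, ∑ j, ∑ k, if i < j ∧ j < k then T i j k else 0 := by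
  have z2 : ∀ i k, T i k i = 0 := fun i k => by rw [h2, h0]
  have z3 : ∀ i k, T k i i = 0 := fun i k => by rw [h1, z2]
  have s1 : ∑ i, ∑ j, ∑ k, (if i < k ∧ k < j then T i j k else 0) =
      ∑ i, ∑ j, ∑ k, if i < j ∧ j < k then T i j k else 0 := by
    refine Finset.sum_congr rfl fun i _ => ?_
    rw [Finset.sum_comm]
    simp only [h2]
  have s2 : ∑ i, ∑ j, ∑ k, (if j < i ∧ i < k then T i j k else 0) =
      ∑ i, ∑ j, ∑ k, if i < j ∧ j < k then T i j k else 0 := by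
    rw [Finset.sum_comm]
    refine Finset.sum_congr rfl fun i _ => Finset.sum_congr rfl fun j _ =>
      Finset.sum_congr rfl fun k _ => ?_
    rw [h1]
  have s3 : ∑ i, ∑ j, ∑ k, (if j < k ∧ k < i then T i j k else 0) =
      ∑ i, ∑ j, ∑ k, if i < j ∧ j < k then T i j k else 0 := by
    rw [← s1, Finset.sum_comm]
    refine Finset.sum_congr rfl fun i _ => Finset.sum_congr rfl fun j _ =>
      Finset.sum_congr rfl fun k _ => ?_
    rw [h1]
  have s4 : ∑ i, ∑ j, ∑ k, (if k < i ∧ i < j then T i j k else 0) =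
      ∑ i, ∑ j, ∑ k, if i < j ∧ j < k then T i j k else 0 := by
    rw [← s2]
    refine Finset.sum_congr rfl fun i _ => ?_
    rw [Finset.sum_comm]
    refine Finset.sum_congr rfl fun j _ => Finset.sum_congr rfl fun k _ => ?_
    rw [h2]
  have s5 : ∑ i, ∑ j, ∑ k, (if k < j ∧ j < i then T i j k else 0) =
      ∑ i, ∑ j, ∑ k, if i < j ∧ j < k then T i j k else 0 := by
    rw [← s3]
    refine Finset.sum_congr rfl fun i _ => ?_
    rw [Finset.sum_comm]
    refine Finset.sum_congr rfl fun j _ => Finset.sum_congr rfl fun k _ => ?_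
    rw [h2]
  have hT : ∀ i j k, T i j k = (if i < j ∧ j < k then T i j k else 0)
      + (if i < k ∧ k < j then T i j k else 0) + (if j < i ∧ i < k then T i j k else 0)
      + (if j < k ∧ k < i then T i j k else 0) + (if k < i ∧ i < j then T i j k else 0)
      + (if k < j ∧ j < i then T i j k else 0) := by
    intro i j k
    by_cases hij : i = j
    · subst hij; simp [h0]
    by_cases hjk : j = k
    · subst hjk; simp [z3]
    by_cases hik : i = k
    · subst hik; simp [z2]
    split_ifs <;> first | (exfalso; omega) | (simp; done)
  have hsum : ∑ i, ∑ j, ∑ k, T i j k = _ := Finset.sum_congr rfl fun i _ =>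
    Finset.sum_congr rfl fun j _ => Finset.sum_congr rfl fun k _ => hT i j k
  rw [hsum]
  simp only [Finset.sum_add_distrib]
  rw [s1, s2, s3, s4, s5]
  ring

lemma euclNorm_sq (φ : Covector 6 3) :
    euclNorm φ ^ 2 = ∑ i, ∑ j, ∑ k, if i < j ∧ j < k then co φ i j k ^ 2 else 0 := by
  unfold euclNorm
  rw [Real.sq_sqrt (Finset.sum_nonneg fun _ _ => sq_nonneg _)]
  rw [sum_strictMono (fun f => (φ (fun i => EuclideanSpace.single (f i) 1)) ^ 2)]
  have : ∀ i j k : Fin 6, (fun a : Fin 3 => (EuclideanSpace.single (![i, j, k] a) 1 : E6)) =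
      ![EuclideanSpace.single i 1, EuclideanSpace.single j 1, EuclideanSpace.single k 1] := by
    intro i j k
    ext a; fin_cases a <;> rfl
  simp only [this, co]

lemma upper (φ : Covector 6 3) : euclNorm φ ≤ 2 * comass φ := by
  have hs : ∑ i, ∑ j, ∑ k, co φ i j k ^ 2 = 6 * euclNorm φ ^ 2 := by
    rw [euclNorm_sq]
    apply sum_all (fun i j k => co φ i j k ^ 2)
    · intro i j k; rw [co_swap1]; ring
    · intro i j k; rw [co_swap2]; ring
    · intro i k
      have : co φ i i k = 0 := by linarith [co_swap1 φ i i k]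
      simp [this]
  have h := Finset.sum_le_sum fun i (_ : i ∈ Finset.univ) => row_le φ i
  rw [hs] at h
  simp at h
  have := comass_nonneg φ
  apply le_of_sq_le_sq _ (by positivity)
  nlinarith

noncomputable def pr (a : Fin 3 → Fin 6) : E6 →ₗ[ℝ] (Fin 3 → ℝ) :=
  LinearMap.funLeft ℝ ℝ a ∘ₗ (WithLp.linearEquiv 2 ℝ (Fin 6 → ℝ)).toLinearMap

noncomputable def dt (a : Fin 3 → Fin 6) : E6 [⋀^Fin 3]→ₗ[ℝ] ℝ :=
  (Matrix.detRowAlternating (n := Fin 3) (R := ℝ)).compLinearMap (pr a)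

/-- The special Lagrangian form. -/
noncomputable def slA : E6 [⋀^Fin 3]→ₗ[ℝ] ℝ :=
  dt ![0, 2, 4] - dt ![0, 3, 5] - dt ![1, 2, 5] - dt ![1, 3, 4]

lemma dt_apply (a : Fin 3 → Fin 6) (v : Fin 3 → E6) :
    dt a v = Matrix.det (Matrix.of fun i j => v i (a j)) := rfl

lemma cs6 (a b : Fin 6 → ℝ) :
    (∑ i, a i * b i) ^ 2 ≤ (∑ i, a i ^ 2) * ∑ i, b i ^ 2 :=
  Finset.sum_mul_sq_le_sq_mul_sq _ _ _

lemma slA_bound (v : Fin 3 → E6) : ‖slA v‖ ≤ 1 * ∏ i, ‖v i‖ := by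
  rw [one_mul, Fin.prod_univ_three, Real.norm_eq_abs]
  apply abs_le_of_sq_le_sq _ (by positivity)
  rw [mul_pow, mul_pow]
  simp only [EuclideanSpace.real_norm_sq_eq]
  set u := v 0 with hu
  set w := v 1 with hw
  set z := v 2 with hz
  let P : Fin 6 → ℝ := ![
    (u 2 * w 4 - u 4 * w 2) - (u 3 * w 5 - u 5 * w 3),
    -((u 2 * w 5 - u 4 * w 3) + (u 3 * w 4 - u 5 * w 2)),
    (u 4 * w 0 - u 0 * w 4) - (u 5 * w 1 - u 1 * w 5),
    -((u 4 * w 1 - u 0 * w 5) + (u 5 * w 0 - u 1 * w 4)),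
    (u 0 * w 2 - u 2 * w 0) - (u 1 * w 3 - u 3 * w 1),
    -((u 0 * w 3 - u 2 * w 1) + (u 1 * w 2 - u 3 * w 0))]
  have h1 : slA v = ∑ i, P i * z i := by
    simp only [slA, AlternatingMap.sub_apply, dt_apply, Matrix.det_fin_three, Fin.sum_univ_six, P,
      Matrix.of_apply, Matrix.cons_val, ← hu, ← hw, ← hz]
    ring
  have h2 := cs6 P z
  have h3 : ∑ i, P i ^ 2 ≤ (∑ i, u i ^ 2) * ∑ i, w i ^ 2 := by
    simp only [Fin.sum_univ_six, P, Matrix.cons_val]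
    nlinarith [sq_nonneg (u 0 * w 0 + u 1 * w 1 + u 2 * w 2 + u 3 * w 3 + u 4 * w 4 + u 5 * w 5),
      sq_nonneg (u 0 * w 1 - u 1 * w 0 + u 2 * w 3 - u 3 * w 2 + u 4 * w 5 - u 5 * w 4)]
  rw [h1]
  refine h2.trans ?_
  gcongr

noncomputable def sl : Covector 6 3 := slA.mkContinuous 1 slA_bound

lemma sl_apply (v : Fin 3 → E6) : sl v = slA v := rfl

lemma sl_norm : euclNorm sl = 2 := by
  have h : euclNorm sl ^ 2 = 4 := by
    rw [euclNorm_sq]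
    simp only [Fin.sum_univ_six, co, sl_apply, slA, AlternatingMap.sub_apply, dt_apply,
      Matrix.det_fin_three, Matrix.of_apply, Matrix.cons_val, EuclideanSpace.single_apply]
    simp
    norm_num
  have h0 : 0 ≤ euclNorm sl := Real.sqrt_nonneg _
  nlinarith

lemma sl_comass : comass sl = 1 := by
  apply le_antisymm
  · apply Real.sSup_le _ zero_le_one
    rintro r ⟨v, hv, rfl⟩
    have h := slA_bound v
    simpa [hv.1, sl_apply] using h
  · have := upper sl
    rw [sl_norm] at this
    linarith

end C63

/-- `C_{6,3} = 2`. -/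
theorem C_six_three_eq_two :
    (∀ φ : Covector 6 3, φ ≠ 0 → euclNorm φ ≤ 2 * comass φ) ∧
    (∃ φ : Covector 6 3, φ ≠ 0 ∧ euclNorm φ = 2 * comass φ) := by
  refine ⟨fun φ _ => C63.upper φ, C63.sl, ?_, ?_⟩
  · intro h
    have h1 := C63.sl_norm
    rw [h] at h1
    simp [euclNorm] at h1
  · rw [C63.sl_norm, C63.sl_comass]; norm_num
end

section
/- The norm-comparison constant C_{8,4} equals √14; that is, every nonzero 4-covector φ on ℝ⁸ satisfies |φ|* ≤ √14 · ‖φ‖*, and there exists a nonzero 4-covector φ on ℝ⁸ with |φ|* = √14 · ‖φ‖*. -/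
open scoped Classical

namespace CayleyAux

/-- Octonion multiplication in coordinates (Cayley–Dickson). -/
def octMul (a b : Fin 8 → ℝ) : Fin 8 → ℝ :=
  ![a 0 * b 0 - a 1 * b 1 - a 2 * b 2 - a 3 * b 3 - a 4 * b 4 - a 5 * b 5 - a 6 * b 6 - a 7 * b 7,
    a 0 * b 1 + a 1 * b 0 + a 2 * b 3 - a 3 * b 2 + a 4 * b 5 - a 5 * b 4 - a 6 * b 7 + a 7 * b 6,
    a 0 * b 2 - a 1 * b 3 + a 2 * b 0 + a 3 * b 1 + a 4 * b 6 + a 5 * b 7 - a 6 * b 4 - a 7 * b 5,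
    a 0 * b 3 + a 1 * b 2 - a 2 * b 1 + a 3 * b 0 + a 4 * b 7 - a 5 * b 6 + a 6 * b 5 - a 7 * b 4,
    a 0 * b 4 - a 1 * b 5 - a 2 * b 6 - a 3 * b 7 + a 4 * b 0 + a 5 * b 1 + a 6 * b 2 + a 7 * b 3,
    a 0 * b 5 + a 1 * b 4 - a 2 * b 7 + a 3 * b 6 - a 4 * b 1 + a 5 * b 0 - a 6 * b 3 + a 7 * b 2,
    a 0 * b 6 + a 1 * b 7 + a 2 * b 4 - a 3 * b 5 - a 4 * b 2 + a 5 * b 3 + a 6 * b 0 - a 7 * b 1,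
    a 0 * b 7 - a 1 * b 6 + a 2 * b 5 + a 3 * b 4 - a 4 * b 3 - a 5 * b 2 + a 6 * b 1 + a 7 * b 0]

/-- Octonion conjugation. -/
def octConj (a : Fin 8 → ℝ) : Fin 8 → ℝ :=
  ![a 0, -a 1, -a 2, -a 3, -a 4, -a 5, -a 6, -a 7]

lemma octMul_norm (a b : Fin 8 → ℝ) :
    ∑ i, octMul a b i ^ 2 = (∑ i, a i ^ 2) * ∑ i, b i ^ 2 := by
  simp [Fin.sum_univ_eight, octMul]
  ring

lemma octConj_norm (a : Fin 8 → ℝ) : ∑ i, octConj a i ^ 2 = ∑ i, a i ^ 2 := by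
  simp [Fin.sum_univ_eight, octConj]

/-- The fourteen index sets of the Cayley form. -/
def tbl : Fin 14 → Fin 4 → Fin 8 :=
  ![![0, 1, 2, 3], ![0, 1, 4, 5], ![0, 1, 6, 7], ![0, 2, 4, 6], ![0, 2, 5, 7], ![0, 3, 4, 7],
    ![0, 3, 5, 6], ![1, 2, 4, 7], ![1, 2, 5, 6], ![1, 3, 4, 6], ![1, 3, 5, 7], ![2, 3, 4, 5],
    ![2, 3, 6, 7], ![4, 5, 6, 7]]

/-- The fourteen signs of the Cayley form, as integers. -/
def sgn : Fin 14 → ℤ := ![1, 1, -1, 1, 1, 1, -1, -1, 1, 1, 1, -1, 1, 1]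

/-- The Cayley form as an alternating map. -/
noncomputable def cayleyAlt : (EuclideanSpace ℝ (Fin 8)) [⋀^Fin 4]→ₗ[ℝ] ℝ :=
  ∑ k, (sgn k : ℝ) • (Matrix.detRowAlternating (R := ℝ) (n := Fin 4)).compLinearMap
    ((LinearMap.funLeft ℝ ℝ (tbl k)) ∘ₗ
      (WithLp.linearEquiv 2 ℝ (Fin 8 → ℝ)).toLinearMap)

lemma cayleyAlt_apply (v : Fin 4 → EuclideanSpace ℝ (Fin 8)) :
    cayleyAlt v = ∑ k, (sgn k : ℝ) * Matrix.det (Matrix.of fun i j => v i (tbl k j)) := by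
  have h : ∀ (s : Finset (Fin 14))
      (F : Fin 14 → (EuclideanSpace ℝ (Fin 8)) [⋀^Fin 4]→ₗ[ℝ] ℝ),
      (∑ k ∈ s, F k) v = ∑ k ∈ s, F k v := by
    intro s F
    induction s using Finset.induction_on with
    | empty => simp
    | insert a s ha ih => rw [Finset.sum_insert ha, Finset.sum_insert ha, ← ih]; rfl
  rw [cayleyAlt, h]
  rfl

/-- The Cayley form. -/
noncomputable def cayley : Covector 8 4 :=
  { cayleyAlt with
    cont := by
      change Continuous fun v => cayleyAlt v
      simp only [cayleyAlt_apply]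
      refine continuous_finsetSum _ fun k _ => continuous_const.mul (Continuous.matrix_det ?_)
      refine continuous_matrix fun i j => ?_
      simp only [Matrix.of_apply]
      fun_prop }

lemma cayley_apply (v : Fin 4 → EuclideanSpace ℝ (Fin 8)) :
    cayley v = ∑ k, (sgn k : ℝ) * Matrix.det (Matrix.of fun i j => v i (tbl k j)) :=
  cayleyAlt_apply v

lemma det_four (A : Fin 4 → Fin 4 → ℝ) : Matrix.det (Matrix.of A) =
    (A 0 0 * A 1 1 - A 0 1 * A 1 0) * (A 2 2 * A 3 3 - A 2 3 * A 3 2)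
    - (A 0 0 * A 1 2 - A 0 2 * A 1 0) * (A 2 1 * A 3 3 - A 2 3 * A 3 1)
    + (A 0 0 * A 1 3 - A 0 3 * A 1 0) * (A 2 1 * A 3 2 - A 2 2 * A 3 1)
    + (A 0 1 * A 1 2 - A 0 2 * A 1 1) * (A 2 0 * A 3 3 - A 2 3 * A 3 0)
    - (A 0 1 * A 1 3 - A 0 3 * A 1 1) * (A 2 0 * A 3 2 - A 2 2 * A 3 0)
    + (A 0 2 * A 1 3 - A 0 3 * A 1 2) * (A 2 0 * A 3 1 - A 2 1 * A 3 0) := by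
  simp [Matrix.det_succ_row_zero, Fin.sum_univ_succ, Fin.succAbove]
  ring

set_option maxHeartbeats 4000000 in
lemma key_identity (x y z w : Fin 8 → ℝ) :
    ∑ i, x i * octMul y (octMul (octConj z) w) i =
      (∑ k, (sgn k : ℝ) * Matrix.det (Matrix.of fun i j => (![x, y, z, w] i) (tbl k j)))
      + (∑ i, x i * y i) * (∑ i, z i * w i) - (∑ i, x i * z i) * (∑ i, y i * w i)
      + (∑ i, x i * w i) * (∑ i, y i * z i) := by
  simp only [det_four, Fin.sum_univ_eight, Fin.sum_univ_succ (n := 13), Fin.sum_univ_succ (n := 12),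
    Fin.sum_univ_succ (n := 11), Fin.sum_univ_succ (n := 10), Fin.sum_univ_succ (n := 9),
    Fin.sum_univ_succ (n := 8)]
  simp [octMul, octConj, sgn, tbl]
  ring

lemma cayley_le (v : Fin 4 → EuclideanSpace ℝ (Fin 8)) (hv : Orthonormal ℝ v) :
    |cayley v| ≤ 1 := by
  have hin : ∀ i j, ∑ l, v i l * v j l = if i = j then 1 else 0 := by
    intro i j
    have h := (orthonormal_iff_ite.1 hv) j i
    rw [PiLp.inner_apply] at h
    simpa [eq_comm] using h
  have hsq : ∀ i, ∑ l, v i l ^ 2 = 1 := by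
    intro i
    have := hin i i
    simpa [pow_two] using this
  have h := key_identity (v 0) (v 1) (v 2) (v 3)
  have hvv : (∑ k, (sgn k : ℝ) * Matrix.det (Matrix.of fun i j =>
      ((![(v 0 : Fin 8 → ℝ), v 1, v 2, v 3] : Fin 4 → Fin 8 → ℝ) i) (tbl k j))) = cayley v := by
    rw [cayley_apply]
    refine Finset.sum_congr rfl fun k _ => ?_
    congr 3
    ext i j
    fin_cases i <;> rfl
  rw [hvv] at h
  simp only [hin] at h
  simp at h
  have hcs := Finset.sum_mul_sq_le_sq_mul_sq Finset.univ (fun i => v 0 i)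
    (octMul (v 1) (octMul (octConj (v 2)) (v 3)))
  rw [h, octMul_norm, octMul_norm, octConj_norm, hsq, hsq, hsq, hsq] at hcs
  rw [abs_le]
  constructor <;> nlinarith

lemma tbl_strictMono (k : Fin 14) : StrictMono (tbl k) := by
  revert k
  unfold StrictMono
  decide

lemma tbl_inj : Function.Injective tbl := by
  unfold Function.Injective
  decide

lemma det_delta (p q : Fin 4 → Fin 8) (hp : StrictMono p) (hq : StrictMono q) :
    Matrix.det (Matrix.of fun i j => (EuclideanSpace.single (p i) (1:ℝ)) (q j))
      = if p = q then 1 else 0 := by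
  split_ifs with h
  · subst h
    rw [← Matrix.det_one (n := Fin 4) (R := ℝ)]
    congr 1
    ext i j
    simp [Matrix.one_apply, hp.injective.eq_iff, eq_comm]
  · have : ∃ i, p i ∉ Set.range q := by
      by_contra hc
      push Not at hc
      apply h
      apply (StrictMono.range_inj hp hq).1
      apply Set.eq_of_subset_of_ncard_le
      · rintro _ ⟨i, rfl⟩
        exact hc i
      · rw [← Set.image_univ, ← Set.image_univ, Set.ncard_image_of_injective _ hp.injective,
          Set.ncard_image_of_injective _ hq.injective]
      · exact Set.toFinite _
    obtain ⟨i, hi⟩ := this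
    apply Matrix.det_eq_zero_of_row_eq_zero i
    intro j
    have : q j ≠ p i := fun e => hi ⟨j, e⟩
    simp [this]

lemma cayley_tbl (k : Fin 14) :
    (cayley fun i => EuclideanSpace.single (tbl k i) 1) ^ 2 = 1 := by
  rw [cayley_apply]
  have : ∀ l, (sgn l : ℝ) * Matrix.det (Matrix.of fun i j =>
      (EuclideanSpace.single (tbl k i) (1:ℝ)) (tbl l j)) = if k = l then (sgn l : ℝ) else 0 := by
    intro l
    rw [det_delta _ _ (tbl_strictMono k) (tbl_strictMono l)]
    simp [tbl_inj.eq_iff]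
  rw [Finset.sum_congr rfl fun l _ => this l]
  simp only [Finset.sum_ite_eq, Finset.mem_univ, if_true]
  have h : ∀ k, sgn k ^ 2 = 1 := by decide
  exact_mod_cast h k

lemma cayley_eucl : Real.sqrt 14 ≤ euclNorm cayley := by
  unfold euclNorm
  apply Real.sqrt_le_sqrt
  let e : Fin 14 ↪ {f : Fin 4 → Fin 8 // StrictMono f} :=
    ⟨fun k => ⟨tbl k, tbl_strictMono k⟩, fun a b h => tbl_inj (congrArg Subtype.val h)⟩
  calc (14 : ℝ) = ∑ k : Fin 14, (cayley fun i => EuclideanSpace.single (tbl k i) 1) ^ 2 := by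
        simp [cayley_tbl]
    _ = ∑ f ∈ Finset.univ.map e, (cayley fun i => EuclideanSpace.single (f.1 i) 1) ^ 2 := by
        rw [Finset.sum_map]
        rfl
    _ ≤ _ := Finset.sum_le_sum_of_subset_of_nonneg (Finset.subset_univ _)
        fun _ _ _ => sq_nonneg _

/-! ### Upper bound -/

lemma le_comass (φ : Covector 8 4) (v : Fin 4 → EuclideanSpace ℝ (Fin 8))
    (hv : Orthonormal ℝ v) : |φ v| ≤ comass φ := by
  unfold comass comassFun
  refine le_csSup ⟨‖φ‖, ?_⟩ ⟨v, hv, rfl⟩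
  rintro _ ⟨w, hw, rfl⟩
  have := φ.le_opNorm w
  simpa [hw.1] using this

lemma comass_nonneg (φ : Covector 8 4) : 0 ≤ comass φ := by
  unfold comass comassFun
  apply Real.sSup_nonneg
  rintro _ ⟨w, hw, rfl⟩
  exact abs_nonneg _

/-- The family of basis vectors attached to a multi-index. -/
noncomputable def bv {p : ℕ} (f : Fin p → Fin 8) : Fin p → EuclideanSpace ℝ (Fin 8) :=
  fun i => EuclideanSpace.single (f i) 1

lemma row_bound (φ : Covector 8 4) (g : Fin 3 → Fin 8) (hg : Function.Injective g) :
    ∑ l, φ (bv (Fin.cons l g)) ^ 2 ≤ comass φ ^ 2 := by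
  set a : Fin 8 → ℝ := fun l => φ (bv (Fin.cons l g)) with ha
  have hbv : ∀ l, bv (Fin.cons l g : Fin 4 → Fin 8)
      = Fin.cons (EuclideanSpace.single l 1) (bv g) := by
    intro l
    funext i
    refine Fin.cases ?_ (fun j => ?_) i <;> simp [bv]
  have ha0 : ∀ i, a (g i) = 0 := by
    intro i
    apply φ.map_eq_zero_of_eq (bv (Fin.cons (g i) g)) (i := 0) (j := i.succ)
    · simp [bv]
    · exact (Fin.succ_ne_zero i).symm
  set S := ∑ l, a l ^ 2 with hS
  have hS0 : 0 ≤ S := Finset.sum_nonneg fun _ _ => sq_nonneg _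
  change S ≤ _
  rcases hS0.eq_or_lt with h0 | hpos
  · rw [← h0]; positivity
  let u : EuclideanSpace ℝ (Fin 8) := WithLp.toLp 2 a
  have hu : u = ∑ l, a l • EuclideanSpace.single l (1:ℝ) := by
    ext i
    simp [u, Finset.sum_apply, Pi.single_apply]
  have hun : ‖u‖ = Real.sqrt S := by
    rw [EuclideanSpace.norm_eq]
    simp [u, hS]
  have hφ : ∀ c : ℝ, φ (Fin.cons (c • u) (bv g)) = c * S := by
    intro c
    have h1 : φ (Fin.cons (c • u) (bv g)) = c • φ (Fin.cons u (bv g)) :=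
      φ.toMultilinearMap.cons_smul (bv g) c u
    have h2 : φ (Fin.cons u (bv g)) = S := by
      let L : EuclideanSpace ℝ (Fin 8) →ₗ[ℝ] ℝ :=
        { toFun := fun x => φ (Fin.cons x (bv g))
          map_add' := fun x y => φ.toMultilinearMap.cons_add (bv g) x y
          map_smul' := fun c x => φ.toMultilinearMap.cons_smul (bv g) c x }
      change L u = S
      rw [hu, map_sum, hS]
      refine Finset.sum_congr rfl fun l _ => ?_
      rw [map_smul, smul_eq_mul, pow_two]
      congr 1
      change φ (Fin.cons (EuclideanSpace.single l 1) (bv g)) = _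
      rw [← hbv]
    rw [h1, h2, smul_eq_mul]
  have hsq : Real.sqrt S * Real.sqrt S = S := Real.mul_self_sqrt hS0
  have hsp : 0 < Real.sqrt S := Real.sqrt_pos.2 hpos
  have hgo : Orthonormal ℝ (bv g) := by
    have := (EuclideanSpace.orthonormal_single (𝕜 := ℝ) (ι := Fin 8)).comp g hg
    exact this
  have hug : ∀ i, inner ℝ u (bv g i) = 0 := by
    intro i
    simp [bv, u, EuclideanSpace.inner_single_right, ha0]
  have hon : Orthonormal ℝ (Fin.cons ((Real.sqrt S)⁻¹ • u) (bv g) :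
      Fin 4 → EuclideanSpace ℝ (Fin 8)) := by
    constructor
    · intro i
      refine Fin.cases ?_ (fun j => ?_) i
      · simp only [Fin.cons_zero]
        rw [norm_smul, hun, norm_inv, Real.norm_of_nonneg hsp.le, inv_mul_cancel₀ hsp.ne']
      · simpa using hgo.1 j
    · intro i j
      refine Fin.cases ?_ (fun i => ?_) i <;> refine Fin.cases ?_ (fun j => ?_) j <;> intro hij
      · exact absurd rfl hij
      · simp [inner_smul_left, hug]
      · simp only [Fin.cons_zero, Fin.cons_succ]
        rw [real_inner_comm, inner_smul_left, hug, mul_zero]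
      · simp only [Fin.cons_succ]
        exact hgo.2 (fun h => hij (by rw [h]))
  have h := le_comass φ _ hon
  rw [hφ] at h
  have h3 : (Real.sqrt S)⁻¹ * S = Real.sqrt S := by
    field_simp
    nlinarith
  rw [h3, abs_of_pos hsp] at h
  nlinarith

lemma sum_all_le (φ : Covector 8 4) :
    ∑ f : Fin 4 → Fin 8, φ (bv f) ^ 2 ≤ 336 * comass φ ^ 2 := by
  have h1 : ∑ f : Fin 4 → Fin 8, φ (bv f) ^ 2
      = ∑ g : Fin 3 → Fin 8, ∑ l, φ (bv (Fin.cons l g)) ^ 2 := by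
    rw [← (Fin.consEquiv (fun _ : Fin 4 => Fin 8)).sum_comp, Fintype.sum_prod_type,
      Finset.sum_comm]
    rfl
  rw [h1]
  have h2 : ∀ g : Fin 3 → Fin 8, ∑ l, φ (bv (Fin.cons l g)) ^ 2
      ≤ if Function.Injective g then comass φ ^ 2 else 0 := by
    intro g
    split_ifs with hg
    · exact row_bound φ g hg
    · apply le_of_eq
      apply Finset.sum_eq_zero
      intro l _
      unfold Function.Injective at hg
      push Not at hg
      obtain ⟨i, j, hij, hne⟩ := hg
      have : φ (bv (Fin.cons l g)) = 0 := by
        apply φ.map_eq_zero_of_eq _ (i := i.succ) (j := j.succ)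
        · simp [bv, hij]
        · exact fun h => hne (Fin.succ_injective _ h)
      rw [this]; norm_num
  refine (Finset.sum_le_sum fun g _ => h2 g).trans (le_of_eq ?_)
  rw [← Finset.sum_filter, Finset.sum_const, nsmul_eq_mul]
  have : (Finset.univ.filter fun g : Fin 3 → Fin 8 => Function.Injective g).card = 336 := by
    rw [← Fintype.card_subtype,
      Fintype.card_congr (Equiv.subtypeInjectiveEquivEmbedding (Fin 3) (Fin 8)),
      Fintype.card_embedding_eq]
    simp [Nat.descFactorial]
  rw [this]; norm_num

lemma sum_strict_le (φ : Covector 8 4) :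
    24 * ∑ f : {f : Fin 4 → Fin 8 // StrictMono f}, φ (bv f.1) ^ 2
      ≤ ∑ f : Fin 4 → Fin 8, φ (bv f) ^ 2 := by
  let e : {f : Fin 4 → Fin 8 // StrictMono f} × Equiv.Perm (Fin 4) ↪ (Fin 4 → Fin 8) :=
    ⟨fun q => q.1.1 ∘ q.2, by
      rintro ⟨⟨f, hf⟩, s⟩ ⟨⟨f', hf'⟩, s'⟩ h
      simp only at h
      have hr : f = f' := by
        apply (StrictMono.range_inj hf hf').1
        have := congrArg Set.range h
        rwa [s.surjective.range_comp, s'.surjective.range_comp] at this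
      subst hr
      have : s = s' := by
        ext i
        have := hf.injective (congrFun h i)
        rw [this]
      rw [this]⟩
  have hs : ∀ q, φ (bv (e q)) ^ 2 = φ (bv q.1.1) ^ 2 := by
    intro q
    have : φ (bv q.1.1 ∘ q.2) = Equiv.Perm.sign q.2 • φ (bv q.1.1) :=
      φ.toAlternatingMap.map_perm _ _
    change φ (bv q.1.1 ∘ q.2) ^ 2 = _
    rw [this]
    rcases Int.units_eq_one_or (Equiv.Perm.sign q.2) with h | h <;> rw [h] <;> simp
  calc _ = ∑ q : {f : Fin 4 → Fin 8 // StrictMono f} × Equiv.Perm (Fin 4),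
          φ (bv q.1.1) ^ 2 := by
        rw [Fintype.sum_prod_type, Finset.mul_sum]
        refine Finset.sum_congr rfl fun f _ => ?_
        simp [Fintype.card_perm, Nat.factorial]
    _ = ∑ f ∈ Finset.univ.map e, φ (bv f) ^ 2 := by
        rw [Finset.sum_map]
        exact Finset.sum_congr rfl fun q _ => (hs q).symm
    _ ≤ _ := Finset.sum_le_sum_of_subset_of_nonneg (Finset.subset_univ _)
        fun _ _ _ => sq_nonneg _

lemma upper (φ : Covector 8 4) : euclNorm φ ≤ Real.sqrt 14 * comass φ := by
  have h1 := sum_all_le φ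
  have h2 := sum_strict_le φ
  unfold euclNorm
  rw [← Real.sqrt_sq (comass_nonneg φ), ← Real.sqrt_mul (by norm_num)]
  apply Real.sqrt_le_sqrt
  change ∑ f : {f : Fin 4 → Fin 8 // StrictMono f}, φ (bv f.1) ^ 2 ≤ _
  linarith

lemma cayley_comass : comass cayley ≤ 1 := by
  unfold comass comassFun
  apply Real.sSup_le _ zero_le_one
  rintro _ ⟨v, hv, rfl⟩
  exact cayley_le v hv

end CayleyAux

/-- `C_{8,4} = √14`. -/
theorem C_eight_four_eq_sqrt_fourteen :
    (∀ φ : Covector 8 4, φ ≠ 0 → euclNorm φ ≤ Real.sqrt 14 * comass φ) ∧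
    (∃ φ : Covector 8 4, φ ≠ 0 ∧ euclNorm φ = Real.sqrt 14 * comass φ) := by
  refine ⟨fun φ _ => CayleyAux.upper φ, CayleyAux.cayley, ?_, ?_⟩
  · intro h
    have := CayleyAux.cayley_tbl 0
    rw [h] at this
    simp at this
  · refine le_antisymm (CayleyAux.upper _) ?_
    refine le_trans ?_ CayleyAux.cayley_eucl
    exact mul_le_of_le_one_right (Real.sqrt_nonneg _) CayleyAux.cayley_comass
end

section
/- Let 0 < p < n, let φ be a p-covector on ℝⁿ and ψ an (n-p)-covector on ℝⁿ. Then |(φ∧ψ)(e₁,…,eₙ)| ≤ |φ|* · |ψ|*, where e₁,…,eₙ is the standard orthonormal basis of ℝⁿ. -/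
open scoped Classical

/-- The wedge product of a `p`-covector and a `q`-covector, as a function of
`p+q` vectors. -/
noncomputable def wedgeApply {n p q : ℕ} (φ : Covector n p) (ψ : Covector n q)
    (v : Fin (p + q) → EuclideanSpace ℝ (Fin n)) : ℝ :=
  (1 / ((p.factorial : ℝ) * (q.factorial : ℝ))) *
    ∑ σ : Equiv.Perm (Fin (p + q)),
      ((Equiv.Perm.sign σ : ℤ) : ℝ) *
        (φ (fun i => v (σ (Fin.castAdd q i))) * ψ (fun i => v (σ (Fin.natAdd p i))))

lemma covector_comp_perm_sq {n p : ℕ} (φ : Covector n p)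
    (v : Fin p → EuclideanSpace ℝ (Fin n)) (τ : Equiv.Perm (Fin p)) :
    (φ (fun i => v (τ i))) ^ 2 = (φ v) ^ 2 := by
  have h := φ.toAlternatingMap.map_perm v τ
  have h2 : φ (fun i => v (τ i)) = Equiv.Perm.sign τ • φ v := h
  rw [h2]
  rcases Int.units_eq_one_or (Equiv.Perm.sign τ) with h | h <;> simp [h]

lemma strictMono_comp_sort {m p : ℕ} (h : Fin p → Fin m) (hh : Function.Injective h) :
    StrictMono (h ∘ Tuple.sort h) :=
  (Tuple.monotone_sort h).strictMono_of_injective (hh.comp (Tuple.sort h).injective)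

lemma sum_perm_sq_le {m p q : ℕ} (φ : Covector m p) (a : Fin p → Fin m) (b : Fin q → Fin m)
    (ha : Function.Injective a) (hb : Function.Injective b)
    (hab : Set.range b = (Set.range a)ᶜ) :
    ∑ σ : Equiv.Perm (Fin m), (φ (fun i => EuclideanSpace.single (σ (a i)) 1)) ^ 2
      ≤ (p.factorial : ℝ) * q.factorial *
        ∑ f : {f : Fin p → Fin m // StrictMono f},
          (φ (fun i => EuclideanSpace.single (f.1 i) 1)) ^ 2 := by
  let F : {f : Fin p → Fin m // StrictMono f} → ℝ := fun f =>
    (φ (fun i => EuclideanSpace.single (f.1 i) 1)) ^ 2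
  have hA : ∀ σ : Equiv.Perm (Fin m), Function.Injective (σ ∘ a) :=
    fun σ => σ.injective.comp ha
  have hB : ∀ σ : Equiv.Perm (Fin m), Function.Injective (σ ∘ b) :=
    fun σ => σ.injective.comp hb
  let T : Equiv.Perm (Fin m) →
      {f : Fin p → Fin m // StrictMono f} × Equiv.Perm (Fin p) × Equiv.Perm (Fin q) :=
    fun σ => (⟨_, strictMono_comp_sort _ (hA σ)⟩, Tuple.sort (σ ∘ a), Tuple.sort (σ ∘ b))
  have hT : Function.Injective T := by
    intro σ σ' h
    simp only [T, Prod.mk.injEq, Subtype.mk.injEq] at h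
    obtain ⟨h1, h2, h3⟩ := h
    have e1 : σ ∘ a = σ' ∘ a := by
      rw [h2] at h1
      exact (Tuple.sort (σ' ∘ a)).surjective.injective_comp_right h1
    have hr : Set.range (σ ∘ b) = Set.range (σ' ∘ b) := by
      rw [Set.range_comp, Set.range_comp, hab, Set.image_compl_eq σ.bijective,
        Set.image_compl_eq σ'.bijective, ← Set.range_comp, ← Set.range_comp, e1]
    have e2 : (σ ∘ b) ∘ Tuple.sort (σ ∘ b) = (σ' ∘ b) ∘ Tuple.sort (σ' ∘ b) := by
      apply ((strictMono_comp_sort _ (hB σ)).range_inj (strictMono_comp_sort _ (hB σ'))).1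
      rw [(Tuple.sort (σ ∘ b)).surjective.range_comp, (Tuple.sort (σ' ∘ b)).surjective.range_comp,
        hr]
    have e3 : σ ∘ b = σ' ∘ b := by
      rw [h3] at e2
      exact (Tuple.sort (σ' ∘ b)).surjective.injective_comp_right e2
    ext x
    by_cases hx : x ∈ Set.range a
    · obtain ⟨i, rfl⟩ := hx
      exact congrArg Fin.val (congrFun e1 i)
    · have hx' : x ∈ Set.range b := by rw [hab]; exact hx
      obtain ⟨i, rfl⟩ := hx'
      exact congrArg Fin.val (congrFun e3 i)
  calc ∑ σ : Equiv.Perm (Fin m), (φ (fun i => EuclideanSpace.single (σ (a i)) 1)) ^ 2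
      = ∑ σ : Equiv.Perm (Fin m), F (T σ).1 := by
        refine Finset.sum_congr rfl fun σ _ => ?_
        exact (covector_comp_perm_sq φ (fun i => EuclideanSpace.single (σ (a i)) 1)
          (Tuple.sort (σ ∘ a))).symm
    _ = ∑ x ∈ Finset.univ.image T, F x.1 := by
        rw [Finset.sum_image (fun x _ y _ h => hT h)]
    _ ≤ ∑ x : {f : Fin p → Fin m // StrictMono f} × Equiv.Perm (Fin p) × Equiv.Perm (Fin q),
          F x.1 :=
        Finset.sum_le_sum_of_subset_of_nonneg (Finset.subset_univ _)
          (fun x _ _ => sq_nonneg _)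
    _ = _ := by
        rw [Fintype.sum_prod_type]
        simp only [Finset.sum_const, Finset.card_univ, Fintype.card_prod, Fintype.card_perm,
          Fintype.card_fin, nsmul_eq_mul, Finset.mul_sum, F]
        push_cast
        rfl

lemma abs_wedge_le_aux {n p q : ℕ} (h : p + q = n) (φ : Covector n p) (ψ : Covector n q) :
    |wedgeApply φ ψ (fun i => EuclideanSpace.single (Fin.cast h i) 1)|
      ≤ euclNorm φ * euclNorm ψ := by
  subst h
  have hab : Set.range (Fin.natAdd p : Fin q → Fin (p + q))
      = (Set.range (Fin.castAdd q : Fin p → Fin (p + q)))ᶜ := by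
    ext x
    refine Fin.addCases (fun i => ?_) (fun i => ?_) x
    · simp [Fin.ext_iff]
      intro y
      omega
    · simp [Fin.ext_iff]
      intro y
      omega
  have hφ := sum_perm_sq_le φ _ _ (Fin.castAdd_injective p q) (Fin.natAdd_injective q p) hab
  have hψ := sum_perm_sq_le ψ _ _ (Fin.natAdd_injective q p) (Fin.castAdd_injective p q)
    (by rw [hab, compl_compl])
  have hc : (0 : ℝ) < (p.factorial : ℝ) * q.factorial := by positivity
  unfold wedgeApply euclNorm
  rw [abs_mul, abs_of_pos (by positivity), one_div, inv_mul_le_iff₀ hc]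
  simp only [Fin.cast_eq_self]
  set P := ∑ f : {f : Fin p → Fin (p + q) // StrictMono f},
          (φ (fun i => EuclideanSpace.single (f.1 i) 1)) ^ 2
  set Q := ∑ f : {f : Fin q → Fin (p + q) // StrictMono f},
          (ψ (fun i => EuclideanSpace.single (f.1 i) 1)) ^ 2
  have hP : 0 ≤ P := Finset.sum_nonneg fun _ _ => sq_nonneg _
  have hQ : 0 ≤ Q := Finset.sum_nonneg fun _ _ => sq_nonneg _
  apply abs_le_of_sq_le_sq _ (by positivity)
  simp only [← mul_assoc]
  refine (Finset.sum_mul_sq_le_sq_mul_sq _ _ _).trans ?_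
  have hs : ∀ σ : Equiv.Perm (Fin (p + q)), (((Equiv.Perm.sign σ : ℤ) : ℝ)) ^ 2 = 1 := by
    intro σ
    rcases Int.units_eq_one_or (Equiv.Perm.sign σ) with h | h <;> simp [h]
  simp only [mul_pow, hs, one_mul, Real.sq_sqrt hP, Real.sq_sqrt hQ]
  calc _ ≤ ((p.factorial : ℝ) * q.factorial * P) * ((q.factorial : ℝ) * p.factorial * Q) :=
        mul_le_mul hφ hψ (Finset.sum_nonneg fun _ _ => sq_nonneg _) (by positivity)
    _ = _ := by ring

/-- `|(φ∧ψ)(e₁,…,eₙ)| ≤ |φ|* · |ψ|*` for a `p`-covector `φ` and an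
`(n-p)`-covector `ψ` on `ℝⁿ`. -/
theorem abs_wedge_top_le_euclNorm_mul (n p : ℕ) (hp : 0 < p) (hpn : p < n)
    (φ : Covector n p) (ψ : Covector n (n - p)) :
    |wedgeApply φ ψ (fun i => EuclideanSpace.single
        (Fin.cast (Nat.add_sub_cancel' hpn.le) i) 1)|
      ≤ euclNorm φ * euclNorm ψ := by
  exact abs_wedge_le_aux _ φ ψ
end

section
/- For all integers n and p with 1 ≤ p ≤ n/2, the binomial coefficients satisfy C(n,p) ≤ (n - p + 1) · C(n-2, p-1), and the inequality is strict unless p = 1 or (n,p) = (4,2). -/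
/-- For `1 ≤ p ≤ n/2`, `binom(n,p) ≤ (n-p+1) · binom(n-2,p-1)`, with strict
inequality unless `p = 1` or `(n,p) = (4,2)`. -/
theorem choose_le_mul_choose (n p : ℕ) (h1 : 1 ≤ p) (h2 : p ≤ n / 2) :
    n.choose p ≤ (n - p + 1) * (n - 2).choose (p - 1) ∧
    (¬ (p = 1 ∨ (n = 4 ∧ p = 2)) →
      n.choose p < (n - p + 1) * (n - 2).choose (p - 1)) := by
  obtain ⟨a, rfl⟩ : ∃ a, p = a + 1 := ⟨p - 1, by omega⟩
  obtain ⟨b, rfl⟩ : ∃ b, n = 2 * a + b + 2 := ⟨n - (2 * a + 2), by omega⟩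
  have e1 : 2 * a + b + 2 - (a + 1) + 1 = a + b + 2 := by omega
  have e2 : 2 * a + b + 2 - 2 = 2 * a + b := by omega
  have e3 : a + 1 - 1 = a := by omega
  rw [e1, e2, e3]
  have k1 := Nat.add_one_mul_choose_eq (2 * a + b + 1) a
  have k2 := Nat.choose_mul_succ_eq (2 * a + b) a
  have e4 : 2 * a + b + 1 - a = a + b + 1 := by omega
  rw [e4] at k2
  have hC : 0 < (2 * a + b).choose a := Nat.choose_pos (by omega)
  generalize (2 * a + b).choose a = C at *
  generalize (2 * a + b + 1).choose a = D at *
  change (2 * a + b + 2) * D = (2 * a + b + 2).choose (a + 1) * (a + 1) at k1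
  generalize (2 * a + b + 2).choose (a + 1) = E at *
  have key : (a + 1) * (a + b + 1) * E = (2 * a + b + 2) * (2 * a + b + 1) * C := by
    calc _ = (a + b + 1) * (E * (a + 1)) := by ring
      _ = (2 * a + b + 2) * (D * (a + b + 1)) := by rw [← k1]; ring
      _ = _ := by rw [← k2]; ring
  have hpos : 0 < (a + 1) * (a + b + 1) := by positivity
  rcases Nat.eq_zero_or_pos a with rfl | ha
  · refine ⟨?_, fun h => absurd (Or.inl rfl) h⟩
    apply Nat.le_of_mul_le_mul_left _ hpos
    rw [key]; apply le_of_eq; ring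
  · obtain ⟨c, rfl⟩ : ∃ c, a = c + 1 := ⟨a - 1, by omega⟩
    constructor
    · apply Nat.le_of_mul_le_mul_left _ hpos
      rw [key, ← mul_assoc]
      apply Nat.mul_le_mul_right
      ring_nf
      nlinarith [Nat.zero_le (b * c), Nat.zero_le (b * c * c), Nat.zero_le (b * b * c)]
    · intro h
      apply Nat.lt_of_mul_lt_mul_left (a := (c + 1 + 1) * (c + 1 + b + 1))
      rw [key, ← mul_assoc]
      apply Nat.mul_lt_mul_of_pos_right _ hC
      have : 0 < b + c := by omega
      ring_nf
      nlinarith [Nat.zero_le (b * c), Nat.zero_le (b * c * c), Nat.zero_le (b * b * c), Nat.zero_le (b * b), Nat.zero_le (c * c), Nat.zero_le (c * c * c)]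
end
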